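/- Let V = V^+ ⊕ V̂ ⊕ V^− and V' = V'^+ ⊕ V̂' ⊕ V'^− be Witt decompositions of isometric nonsingular metric spaces V and V' over F. An isometry φ : E → E' between subspaces E ⊆ V and E' ⊆ V' can be extended to an isometry φ_V : V → V' with φ_V(V^+) = V'^+, φ_V(V̂) = V̂', and φ_V(V^−) = V'^− if and only if φ(E ∩ (V^+ + V^−)) = E' ∩ (V'^+ + V'^−), φ(E ∩ (V^− + V̂)) = E' ∩ (V'^− + V̂'), φ(E ∩ (V̂ + V^+)) = E' ∩ (V̂' + V'^+), and the induced map φ̃_{V^+,V̂,V^−} : P_{V^+,V̂,V^−}(E) → P_{V'^+,V̂',V'^−}(E') is an isometry. -/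

import Mathlib

open Module

namespace Witt

variable {F V V' : Type*} [Field F] [AddCommGroup V] [Module F V]
  [AddCommGroup V'] [Module F V']

/-- A linear equivalence `φ : E ≃ E'` between subspaces is an isometry if it
preserves the ambient bilinear forms. -/
def IsIsometryOn (B : LinearMap.BilinForm F V) (B' : LinearMap.BilinForm F V')
    (E : Submodule F V) (E' : Submodule F V') (φ : E ≃ₗ[F] E') : Prop :=
  ∀ u v : E, B' (φ u : V') (φ v : V') = B (u : V) (v : V)

/-- A linear equivalence of the whole spaces which preserves the forms. -/
def IsIsometry (B : LinearMap.BilinForm F V) (B' : LinearMap.BilinForm F V')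
    (ψ : V ≃ₗ[F] V') : Prop :=
  ∀ u v : V, B' (ψ u) (ψ v) = B u v

/-- The two metric spaces `(V,B)` and `(V',B')` are isometric. -/
def AreIsometric (B : LinearMap.BilinForm F V) (B' : LinearMap.BilinForm F V') : Prop :=
  ∃ ψ : V ≃ₗ[F] V', IsIsometry B B' ψ

/-- The subspaces `N ⊆ V` and `N' ⊆ V'` are isometric with respect to the
restrictions of the ambient forms. -/
def SubIsometric (B : LinearMap.BilinForm F V) (B' : LinearMap.BilinForm F V')
    (N : Submodule F V) (N' : Submodule F V') : Prop :=
  ∃ ψ : N ≃ₗ[F] N', IsIsometryOn B B' N N' ψ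

/-- A subspace is totally isotropic. -/
def TotIsotropic (B : LinearMap.BilinForm F V) (N : Submodule F V) : Prop :=
  ∀ u ∈ N, ∀ v ∈ N, B u v = 0

end Witt

open Module Witt

/-- The sum of the projections of `E` onto the three components of the
decomposition `V = A ⊕ B ⊕ C`:
`P_{A,B,C}(E) = ((E+B+C) ∩ A) ⊕ ((E+C+A) ∩ B) ⊕ ((E+A+B) ∩ C)`. -/
def Pproj3 {F V : Type*} [Field F] [AddCommGroup V] [Module F V]
    (A Bs C E : Submodule F V) : Submodule F V :=
  ((E ⊔ Bs ⊔ C) ⊓ A) ⊔ ((E ⊔ C ⊔ A) ⊓ Bs) ⊔ ((E ⊔ A ⊔ Bs) ⊓ C)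

/-- `V = Vp ⊕ Vh ⊕ Vm` is a Witt decomposition of the metric space `(V, B)`:
`Vp` and `Vm` are maximal totally isotropic subspaces of the same dimension,
and `Vh` is an anisotropic subspace orthogonal to both. -/
structure IsWittDecomposition {F V : Type*} [Field F] [AddCommGroup V] [Module F V]
    (B : LinearMap.BilinForm F V) (Vp Vh Vm : Submodule F V) : Prop where
  totIso_p : TotIsotropic B Vp
  totIso_m : TotIsotropic B Vm
  max_p : ∀ N : Submodule F V, TotIsotropic B N → Vp ≤ N → N = Vp
  max_m : ∀ N : Submodule F V, TotIsotropic B N → Vm ≤ N → N = Vm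
  dim_eq : Module.finrank F ↥Vp = Module.finrank F ↥Vm
  aniso : ∀ v ∈ Vh, v ≠ 0 → B v v ≠ 0
  orth_p : ∀ u ∈ Vh, ∀ v ∈ Vp, B u v = 0
  orth_m : ∀ u ∈ Vh, ∀ v ∈ Vm, B u v = 0
  disj_p : Vp ⊓ (Vh ⊔ Vm) = ⊥
  disj_h : Vh ⊓ (Vp ⊔ Vm) = ⊥
  disj_m : Vm ⊓ (Vp ⊔ Vh) = ⊥
  sup_eq : Vp ⊔ Vh ⊔ Vm = ⊤

namespace Witt

variable {F V V' : Type*} [Field F] [AddCommGroup V] [Module F V]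
  [AddCommGroup V'] [Module F V']

section Isometry

variable {B : LinearMap.BilinForm F V} {B' : LinearMap.BilinForm F V'}

theorem IsIsometry.symm {τ : V ≃ₗ[F] V'} (h : IsIsometry B B' τ) : IsIsometry B' B τ.symm := by
  intro u v
  rw [← h, τ.apply_symm_apply, τ.apply_symm_apply]

theorem IsIsometry.trans {V'' : Type*} [AddCommGroup V''] [Module F V'']
    {B'' : LinearMap.BilinForm F V''} {τ : V ≃ₗ[F] V'} {ρ : V' ≃ₗ[F] V''}
    (h : IsIsometry B B' τ) (h' : IsIsometry B' B'' ρ) : IsIsometry B B'' (τ.trans ρ) := by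
  intro u v
  rw [LinearEquiv.trans_apply, LinearEquiv.trans_apply, h', h]

theorem TotIsotropic.map {N : Submodule F V} (hN : TotIsotropic B N) {τ : V ≃ₗ[F] V'}
    (h : IsIsometry B B' τ) : TotIsotropic B' (N.map τ.toLinearMap) := by
  rintro _ ⟨u, hu, rfl⟩ _ ⟨v, hv, rfl⟩
  exact (h u v).trans (hN u hu v hv)

/-- The reflection in a non-isotropic vector. -/
theorem exists_reflection (hB : ∀ u v, B u v = B v u) {c : V} (hc : B c c ≠ 0) :
    ∃ ρ : V ≃ₗ[F] V, IsIsometry B B ρ ∧ ∀ x, ρ x = x - (2 * B c x / B c c) • c := by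
  have hf : ((2 / B c c) • B c) c = 2 := by
    simp [hc]
  refine ⟨Module.reflection hf, fun u v => ?_, fun x => ?_⟩
  · simp only [Module.reflection_apply, LinearMap.smul_apply, map_sub, map_smul,
      LinearMap.sub_apply, smul_eq_mul, hB u c]
    field_simp
    ring
  · rw [Module.reflection_apply, LinearMap.smul_apply, smul_eq_mul, div_mul_eq_mul_div]

/-- Two non-isotropic vectors of the same length are exchanged by an isometry which
fixes everything orthogonal to both. -/
theorem exists_isometry_apply_eq (hchar : (2 : F) ≠ 0) (hB : ∀ u v, B u v = B v u) {a b : V}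
    (ha : B a a ≠ 0) (hab : B b b = B a a) :
    ∃ ρ : V ≃ₗ[F] V, IsIsometry B B ρ ∧ ρ a = b ∧ ∀ x, B a x = 0 → B b x = 0 → ρ x = x := by
  by_cases hc : B (a - b) (a - b) = 0
  · have hd : B (a + b) (a + b) ≠ 0 := by
      intro hd
      apply ha
      have : 2 * 2 * B a a = B (a - b) (a - b) + B (a + b) (a + b) := by
        simp only [map_sub, map_add, LinearMap.sub_apply, LinearMap.add_apply, hab]
        ring
      rw [hc, hd, add_zero] at this
      simpa [hchar] using this
    obtain ⟨ρ, hρ, hρx⟩ := exists_reflection hB hd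
    obtain ⟨σ, hσ, hσx⟩ := exists_reflection hB (c := b) (by rwa [hab])
    have hρa : ρ a = -b := by
      have : 2 * B (a + b) a / B (a + b) (a + b) = 1 := by
        rw [div_eq_one_iff_eq hd]
        simp only [map_add, LinearMap.add_apply, hab, hB b a]
        ring
      rw [hρx, this, one_smul]
      abel
    refine ⟨ρ.trans σ, hρ.trans hσ, ?_, fun x hx hx' => ?_⟩
    · rw [LinearEquiv.trans_apply, hρa, map_neg, hσx, mul_div_assoc,
        div_self (by rwa [hab]), mul_one, two_smul]
      abel
    · rw [LinearEquiv.trans_apply, hρx, LinearMap.map_add, LinearMap.add_apply, hx, hx', add_zero,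
        mul_zero, zero_div, zero_smul, sub_zero, hσx, hx', mul_zero, zero_div, zero_smul, sub_zero]
  · obtain ⟨ρ, hρ, hρx⟩ := exists_reflection hB hc
    refine ⟨ρ, hρ, ?_, fun x hx hx' => ?_⟩
    · have : 2 * B (a - b) a / B (a - b) (a - b) = 1 := by
        rw [div_eq_one_iff_eq hc]
        simp only [map_sub, LinearMap.sub_apply, hab, hB b a]
        ring
      rw [hρx, this, one_smul, sub_sub_cancel]
    · rw [hρx, LinearMap.map_sub, LinearMap.sub_apply, hx, hx', sub_zero, mul_zero, zero_div,
        zero_smul, sub_zero]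

theorem exists_isometry_of_orthogonal_family (hchar : (2 : F) ≠ 0)
    (hB' : ∀ u v, B' u v = B' v u) (hVV' : AreIsometric B B') {n : ℕ} (v : Fin n → V)
    (w : Fin n → V') (hv : ∀ i, B (v i) (v i) ≠ 0) (hvo : ∀ i j, i ≠ j → B (v i) (v j) = 0)
    (hvw : ∀ i j, B' (w i) (w j) = B (v i) (v j)) :
    ∃ τ : V ≃ₗ[F] V', IsIsometry B B' τ ∧ ∀ i, τ (v i) = w i := by
  induction n with
  | zero =>
    obtain ⟨τ, hτ⟩ := hVV'
    exact ⟨τ, hτ, fun i => i.elim0⟩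
  | succ n ih =>
    obtain ⟨τ, hτ, hτv⟩ := ih (fun i => v i.succ) (fun i => w i.succ) (fun i => hv _)
      (fun i j h => hvo _ _ (by simpa using h)) (fun i j => hvw _ _)
    obtain ⟨ρ, hρ, hρa, hρx⟩ := exists_isometry_apply_eq hchar hB' (a := τ (v 0)) (b := w 0)
      (by rw [hτ]; exact hv 0) (by rw [hτ, hvw])
    refine ⟨τ.trans ρ, hτ.trans hρ, fun i => ?_⟩
    rw [LinearEquiv.trans_apply]
    refine Fin.cases hρa (fun i => ?_) i
    have h0 : B (v 0) (v i.succ) = 0 := hvo _ _ (Fin.succ_ne_zero i).symm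
    rw [hτv, hρx]
    · rw [← hτv, hτ, h0]
    · rw [hvw, h0]

/-- Witt's extension theorem for an isometry between nonsingular subspaces, each
parametrized by `U`. -/
theorem exists_isometry_extension {U : Type*} [AddCommGroup U] [Module F U]
    [FiniteDimensional F U] (hchar : (2 : F) ≠ 0) (hB : ∀ u v, B u v = B v u)
    (hB' : ∀ u v, B' u v = B' v u) (hVV' : AreIsometric B B') (i : U →ₗ[F] V) (σ : U →ₗ[F] V')
    (hi : ∀ x, (∀ y, B (i x) (i y) = 0) → x = 0)
    (hσ : ∀ x y, B' (σ x) (σ y) = B (i x) (i y)) :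
    ∃ τ : V ≃ₗ[F] V', IsIsometry B B' τ ∧ ∀ x, τ (i x) = σ x := by
  have : Invertible (2 : F) := invertibleOfNonzero hchar
  let C : LinearMap.BilinForm F U := B.compl₁₂ i i
  obtain ⟨b, hb⟩ := LinearMap.BilinForm.exists_orthogonal_basis (B := C)
    ⟨fun x y => hB (i x) (i y)⟩
  obtain ⟨τ, hτ, hτb⟩ := exists_isometry_of_orthogonal_family hchar hB' hVV'
    (fun j => i (b j)) (fun j => σ (b j))
    (hb.not_isOrtho_basis_self_of_separatingLeft hi) (fun j k h => hb h)
    (fun j k => hσ _ _)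
  refine ⟨τ, hτ, fun x => ?_⟩
  have : τ.toLinearMap ∘ₗ i = σ := b.ext hτb
  exact LinearMap.congr_fun this x

theorem finrank_le_of_maximal_totIsotropic [FiniteDimensional F V] (hB : ∀ u v, B u v = B v u)
    (hnd : B.Nondegenerate) {N M : Submodule F V} (hN : TotIsotropic B N)
    (hM : TotIsotropic B M) (hmax : ∀ L, TotIsotropic B L → M ≤ L → L = M) :
    finrank F N ≤ finrank F M := by
  have h1 : N ⊓ B.orthogonal M ≤ N ⊓ M := by
    rintro x ⟨hxN, hxM⟩
    have hxM' : ∀ w ∈ M, B w x = 0 := hxM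
    refine ⟨hxN, ?_⟩
    have hL : TotIsotropic B (M ⊔ F ∙ x) := by
      intro u hu v hv
      obtain ⟨a, ha, _, hs, rfl⟩ := Submodule.mem_sup.1 hu
      obtain ⟨b, hb, _, ht, rfl⟩ := Submodule.mem_sup.1 hv
      obtain ⟨s, rfl⟩ := Submodule.mem_span_singleton.1 hs
      obtain ⟨t, rfl⟩ := Submodule.mem_span_singleton.1 ht
      simp [hM a ha b hb, hxM' a ha, hB x b, hxM' b hb, hN x hxN x hxN]
    rw [← hmax _ hL le_sup_left]
    exact Submodule.mem_sup_right (Submodule.mem_span_singleton_self x)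
  have h2 : N ⊔ B.orthogonal M ≤ B.orthogonal (N ⊓ M) :=
    sup_le (fun x hx y hy => hN y hy.1 x hx) (fun x hx y hy => hx y hy.2)
  have h3 := Submodule.finrank_sup_add_finrank_inf_eq N (B.orthogonal M)
  have h4 := Submodule.finrank_mono h1
  have h5 := Submodule.finrank_mono h2
  rw [LinearMap.BilinForm.finrank_orthogonal hnd] at h3 h5
  have h6 := Submodule.finrank_le M
  have h7 := Submodule.finrank_le (N ⊓ M)
  omega

end Isometry

/-- An injective partial map over `D` extends to an isomorphism over `D`. -/
theorem exists_linearEquiv_extension_over {D : Type*} [AddCommGroup D] [Module F D]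
    [FiniteDimensional F V] [FiniteDimensional F V'] (hdim : finrank F V = finrank F V')
    {g : V →ₗ[F] D} {g' : V' →ₗ[F] D} (hg : Function.Surjective g)
    (hg' : Function.Surjective g') (p : V →ₗ.[F] V') (hp : Function.Injective p.toFun)
    (hpg : ∀ x, g' (p x) = g x) :
    ∃ f : V ≃ₗ[F] V', (∀ x : p.domain, f x = p x) ∧ ∀ x, g' (f x) = g x := by
  induction hn : finrank F V - finrank F p.domain using Nat.strong_induction_on generalizing p with
  | _ n ih =>
  by_cases htop : p.domain = ⊤
  · let f : V →ₗ[F] V' := p.toFun ∘ₗ (LinearEquiv.ofTop p.domain htop).symm.toLinearMap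
    have hf : Function.Injective f := hp.comp (LinearEquiv.injective _)
    exact ⟨LinearMap.linearEquivOfInjective f hf hdim, fun x => rfl, fun x => hpg _⟩
  obtain ⟨x, hx, y, hy, hxy⟩ : ∃ x ∉ p.domain, ∃ y ∉ LinearMap.range p.toFun, g' y = g x := by
    by_cases hker : LinearMap.ker g ≤ p.domain
    · obtain ⟨x, -, hx⟩ := SetLike.exists_of_lt (lt_top_iff_ne_top.2 htop)
      obtain ⟨y, hy⟩ := hg' (g x)
      refine ⟨x, hx, y, ?_, hy⟩
      rintro ⟨z, rfl⟩
      have hz : x - z ∈ LinearMap.ker g := by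
        rw [LinearMap.mem_ker, map_sub, ← hpg, ← hy]
        exact sub_self _
      exact hx (by simpa using add_mem (hker hz) z.2)
    · obtain ⟨x, hxg, hx⟩ := SetLike.not_le_iff_exists.1 hker
      have hker' : ¬ LinearMap.ker g' ≤ LinearMap.range p.toFun := by
        intro h
        apply hker
        have h1 : LinearMap.ker g' ≤
            ((LinearMap.ker g).comap p.domain.subtype).map p.toFun := by
          intro y hy
          obtain ⟨z, rfl⟩ := h hy
          exact ⟨z, (hpg z).symm.trans hy, rfl⟩
        have h2 := (Submodule.finrank_mono h1).trans (Submodule.finrank_map_le _ _)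
        rw [← Submodule.finrank_map_subtype_eq, Submodule.map_comap_subtype] at h2
        have h3 := g.finrank_range_add_finrank_ker
        have h4 := g'.finrank_range_add_finrank_ker
        rw [LinearMap.range_eq_top.2 hg] at h3
        rw [LinearMap.range_eq_top.2 hg'] at h4
        have h5 := Submodule.eq_of_le_of_finrank_le (inf_le_right : p.domain ⊓ LinearMap.ker g ≤ _)
          (by omega)
        exact inf_eq_right.1 h5
      obtain ⟨y, hyg, hy⟩ := SetLike.not_le_iff_exists.1 hker'
      exact ⟨x, hx, y, hy, (LinearMap.mem_ker.1 hyg).trans (LinearMap.mem_ker.1 hxg).symm⟩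
  let q := p.supSpanSingleton x y hx
  have hqd : q.domain = p.domain ⊔ F ∙ x := p.domain_supSpanSingleton x y hx
  have hpq : p.domain ≤ q.domain := hqd ▸ le_sup_left
  have hqx : ∀ z : q.domain, ∃ (u : p.domain) (c : F), (z : V) = u + c • x ∧
      q z = p u + c • y := by
    rintro ⟨z, hz⟩
    have hz' := hz
    rw [hqd] at hz'
    obtain ⟨u, hu, _, hc, rfl⟩ := Submodule.mem_sup.1 hz'
    obtain ⟨c, rfl⟩ := Submodule.mem_span_singleton.1 hc
    exact ⟨⟨u, hu⟩, c, rfl, p.supSpanSingleton_apply_mk x y hx u hu c⟩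
  have hq : Function.Injective q.toFun := by
    rw [injective_iff_map_eq_zero]
    intro z hz
    obtain ⟨u, c, hzu, hqz⟩ := hqx z
    have h0 : p u + c • y = 0 := hqz.symm.trans hz
    have hc : c = 0 := by
      by_contra hc
      apply hy
      have : c • y ∈ LinearMap.range p.toFun := by
        rw [eq_neg_of_add_eq_zero_right h0]
        exact neg_mem ⟨u, rfl⟩
      simpa [hc] using Submodule.smul_mem _ c⁻¹ this
    rw [hc, zero_smul, add_zero] at h0
    have hu : u = 0 := (injective_iff_map_eq_zero p.toFun).1 hp u h0
    ext
    simp [hzu, hc, hu]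
  have hqg : ∀ z, g' (q z) = g z := by
    intro z
    obtain ⟨u, c, hzu, hqz⟩ := hqx z
    rw [hqz, hzu, map_add, map_add, map_smul, map_smul, hpg, hxy]
  have hlt : finrank F p.domain < finrank F q.domain := by
    refine Submodule.finrank_lt_finrank_of_lt (lt_of_le_of_ne hpq fun h => hx ?_)
    rw [h, hqd]
    exact Submodule.mem_sup_right (Submodule.mem_span_singleton_self x)
  have hle := Submodule.finrank_le q.domain
  obtain ⟨f, hfq, hfg⟩ := ih _ (by omega) q hq hqg rfl
  refine ⟨f, fun u => ?_, hfg⟩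
  rw [hfq ⟨u, hpq u.2⟩]
  exact ((p.left_le_sup _ _).2 (x := u) (y := ⟨u, hpq u.2⟩) rfl).symm

/-- A linear map restricts to the part of its domain lying in a given subspace. -/
theorem exists_restrict {P Y : Submodule F V} {Y' : Submodule F V'} (ψ : P →ₗ[F] V')
    (hψ : ∀ u : P, (u : V) ∈ Y → ψ u ∈ Y') :
    ∃ j : P.comap Y.subtype →ₗ[F] Y', ∀ x, (j x : V') = ψ ⟨x.1, x.2⟩ :=
  ⟨(ψ ∘ₗ (Y.subtype ∘ₗ (P.comap Y.subtype).subtype).codRestrict P fun x => x.2).codRestrict Y'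
    fun x => hψ _ x.1.2, fun _ => rfl⟩

end Witt

section PprojComponents

variable {F V : Type*} [Field F] [AddCommGroup V] [Module F V] {X Y Z E : Submodule F V}

theorem Pproj3_rotate : Pproj3 X Y Z E = Pproj3 Y Z X E := by
  simp only [Pproj3]
  ac_rfl

theorem fst_mem_Pproj3 {a b c : V} (he : a + b + c ∈ E) (ha : a ∈ X) (hb : b ∈ Y) (hc : c ∈ Z) :
    a ∈ Pproj3 X Y Z E := by
  refine Submodule.mem_sup_left (Submodule.mem_sup_left ⟨?_, ha⟩)
  rw [show a = a + b + c + -b + -c by abel]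
  exact add_mem (Submodule.mem_sup_left (add_mem (Submodule.mem_sup_left he)
    (Submodule.mem_sup_right (neg_mem hb)))) (Submodule.mem_sup_right (neg_mem hc))

theorem mem_Pproj3_of_add_mem {a b c : V} (he : a + b + c ∈ E) (ha : a ∈ X) (hb : b ∈ Y)
    (hc : c ∈ Z) : a ∈ Pproj3 X Y Z E ∧ b ∈ Pproj3 X Y Z E ∧ c ∈ Pproj3 X Y Z E := by
  refine ⟨fst_mem_Pproj3 he ha hb hc, ?_, ?_⟩
  · rw [Pproj3_rotate]
    exact fst_mem_Pproj3 (by rwa [show b + c + a = a + b + c by abel]) hb hc ha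
  · rw [← Pproj3_rotate]
    exact fst_mem_Pproj3 (by rwa [show c + a + b = a + b + c by abel]) hc ha hb

/-- An element of `P_{X,Y,Z}(E)` lying in `X` is the `X`-component of an element of `E`. -/
theorem exists_add_mem_of_mem_Pproj3 (hd : X ⊓ (Y ⊔ Z) = ⊥) {u : V} (hu : u ∈ Pproj3 X Y Z E)
    (huX : u ∈ X) : ∃ b ∈ Y, ∃ c ∈ Z, u + b + c ∈ E := by
  obtain ⟨_, hab, c, hc, rfl⟩ := Submodule.mem_sup.1 hu
  obtain ⟨a, ha, b, hb, rfl⟩ := Submodule.mem_sup.1 hab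
  have h0 : b + c ∈ X ⊓ (Y ⊔ Z) := by
    refine ⟨?_, Submodule.add_mem_sup hb.2 hc.2⟩
    have := sub_mem huX ha.2
    rwa [show a + b + c - a = b + c by abel] at this
  rw [hd, Submodule.mem_bot] at h0
  rw [add_assoc, h0, add_zero]
  obtain ⟨_, hey, z, hz, hsum⟩ := Submodule.mem_sup.1 ha.1
  obtain ⟨e, he, y, hy, rfl⟩ := Submodule.mem_sup.1 hey
  refine ⟨-y, neg_mem hy, -z, neg_mem hz, ?_⟩
  rwa [← hsum, show e + y + z + -y + -z = e by abel]

theorem map_Pproj3 {V' : Type*} [AddCommGroup V'] [Module F V'] (τ : V ≃ₗ[F] V') :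
    (Pproj3 X Y Z E).map τ.toLinearMap = Pproj3 (X.map τ.toLinearMap) (Y.map τ.toLinearMap)
      (Z.map τ.toLinearMap) (E.map τ.toLinearMap) := by
  simp only [Pproj3, Submodule.map_sup, Submodule.map_inf _ τ.injective]

end PprojComponents

namespace IsWittDecomposition

variable {F V V' : Type*} [Field F] [AddCommGroup V] [Module F V]
  [AddCommGroup V'] [Module F V'] {B : LinearMap.BilinForm F V} {B' : LinearMap.BilinForm F V'}
  {Vp Vh Vm : Submodule F V} {Vp' Vh' Vm' : Submodule F V'}

theorem swap (h : IsWittDecomposition B Vp Vh Vm) : IsWittDecomposition B Vm Vh Vp where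
  totIso_p := h.totIso_m
  totIso_m := h.totIso_p
  max_p := h.max_m
  max_m := h.max_p
  dim_eq := h.dim_eq.symm
  aniso := h.aniso
  orth_p := h.orth_m
  orth_m := h.orth_p
  disj_p := by rw [sup_comm, h.disj_m]
  disj_h := by rw [sup_comm, h.disj_h]
  disj_m := by rw [sup_comm, h.disj_p]
  sup_eq := by rw [← h.sup_eq]; ac_rfl

theorem exists_eq_add (h : IsWittDecomposition B Vp Vh Vm) (v : V) :
    ∃ a ∈ Vp, ∃ b ∈ Vh, ∃ c ∈ Vm, v = a + b + c := by
  have hv : v ∈ Vp ⊔ Vh ⊔ Vm := h.sup_eq ▸ Submodule.mem_top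
  obtain ⟨_, hab, c, hc, rfl⟩ := Submodule.mem_sup.1 hv
  obtain ⟨a, ha, b, hb, rfl⟩ := Submodule.mem_sup.1 hab
  exact ⟨a, ha, b, hb, c, hc, rfl⟩

theorem eq_zero_of_orth (h : IsWittDecomposition B Vp Vh Vm) (hB : ∀ u v, B u v = B v u)
    (hnd : B.Nondegenerate) {a : V} (ha : a ∈ Vp) (hac : ∀ c ∈ Vm, B a c = 0) : a = 0 := by
  refine hnd.1 a fun v => ?_
  obtain ⟨p, hp, q, hq, c, hc, rfl⟩ := h.exists_eq_add v
  rw [map_add, map_add, h.totIso_p a ha p hp, hB a q, h.orth_p q hq a ha, hac c hc]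
  simp

theorem mem_aniso_iff (h : IsWittDecomposition B Vp Vh Vm) (hB : ∀ u v, B u v = B v u)
    (hnd : B.Nondegenerate) {x : V} :
    x ∈ Vh ↔ (∀ u ∈ Vp, B x u = 0) ∧ ∀ u ∈ Vm, B x u = 0 := by
  refine ⟨fun hx => ⟨h.orth_p x hx, h.orth_m x hx⟩, fun ⟨hp, hm⟩ => ?_⟩
  obtain ⟨a, ha, b, hb, c, hc, rfl⟩ := h.exists_eq_add x
  have ha0 : a = 0 := h.eq_zero_of_orth hB hnd ha fun u hu => by
    simpa [h.orth_m b hb u hu, h.totIso_m c hc u hu] using hm u hu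
  have hc0 : c = 0 := h.swap.eq_zero_of_orth hB hnd hc fun u hu => by
    simpa [h.orth_p b hb u hu, h.totIso_p a ha u hu] using hp u hu
  simpa [ha0, hc0] using hb

theorem exists_equiv_dual [FiniteDimensional F V] (h : IsWittDecomposition B Vp Vh Vm)
    (hB : ∀ u v, B u v = B v u) (hnd : B.Nondegenerate) :
    ∃ e : Vp ≃ₗ[F] Dual F Vm, ∀ a c, e a c = B a c := by
  let f : Vp →ₗ[F] Dual F Vm := B.domRestrict₁₂ Vp Vm
  have hf : Function.Injective f := by
    rw [injective_iff_map_eq_zero]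
    intro a ha
    exact Subtype.ext (h.eq_zero_of_orth hB hnd a.2 fun c hc => LinearMap.congr_fun ha ⟨c, hc⟩)
  exact ⟨LinearMap.linearEquivOfInjective f hf
    (h.dim_eq.trans Subspace.dual_finrank_eq.symm), fun _ _ => rfl⟩

theorem finrank_eq [FiniteDimensional F V] [FiniteDimensional F V']
    (h : IsWittDecomposition B Vp Vh Vm) (h' : IsWittDecomposition B' Vp' Vh' Vm')
    (hB : ∀ u v, B u v = B v u) (hB' : ∀ u v, B' u v = B' v u)
    (hnd : B.Nondegenerate) (hnd' : B'.Nondegenerate) (hVV' : AreIsometric B B') :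
    finrank F Vp = finrank F Vp' := by
  obtain ⟨τ, hτ⟩ := hVV'
  refine le_antisymm ?_ ?_
  · rw [← LinearEquiv.finrank_map_eq τ Vp]
    exact finrank_le_of_maximal_totIsotropic hB' hnd' (h.totIso_p.map hτ) h'.totIso_p h'.max_p
  · rw [← LinearEquiv.finrank_map_eq τ.symm Vp']
    exact finrank_le_of_maximal_totIsotropic hB hnd (h'.totIso_p.map hτ.symm) h.totIso_p h.max_p

/-- Linear isomorphisms of the isotropic parts which preserve the pairing and extend
a given isometry. -/
theorem exists_isotropic_extension [FiniteDimensional F V] [FiniteDimensional F V']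
    (h : IsWittDecomposition B Vp Vh Vm) (h' : IsWittDecomposition B' Vp' Vh' Vm')
    (hB : ∀ u v, B u v = B v u) (hB' : ∀ u v, B' u v = B' v u)
    (hnd : B.Nondegenerate) (hnd' : B'.Nondegenerate) (hVV' : AreIsometric B B')
    {P : Submodule F V} (ψ : P →ₗ[F] V') (hψ : Function.Injective ψ)
    (hiso : ∀ u v, B' (ψ u) (ψ v) = B u v)
    (hp : ∀ u : P, (u : V) ∈ Vp → ψ u ∈ Vp') (hm : ∀ u : P, (u : V) ∈ Vm → ψ u ∈ Vm') :
    ∃ (f : Vp ≃ₗ[F] Vp') (g : Vm ≃ₗ[F] Vm'),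
      (∀ a c, B' (f a) (g c) = B a c) ∧
      (∀ (a : Vp) (ha : (a : V) ∈ P), (f a : V') = ψ ⟨a, ha⟩) ∧
      ∀ (c : Vm) (hc : (c : V) ∈ P), (g c : V') = ψ ⟨c, hc⟩ := by
  obtain ⟨jp, hjp⟩ := exists_restrict ψ hp
  obtain ⟨jm, hjm⟩ := exists_restrict ψ hm
  have hjp_inj : Function.Injective jp := fun x y hxy => by
    have := hψ ((hjp x).symm.trans ((congrArg Subtype.val hxy).trans (hjp y)))
    exact Subtype.ext (Subtype.ext (congrArg (fun z : P => (z : V)) this))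
  have hjm_inj : Function.Injective jm := fun x y hxy => by
    have := hψ ((hjm x).symm.trans ((congrArg Subtype.val hxy).trans (hjm y)))
    exact Subtype.ext (Subtype.ext (congrArg (fun z : P => (z : V)) this))
  obtain ⟨e, he⟩ := h.exists_equiv_dual hB hnd
  obtain ⟨e', he'⟩ := h'.exists_equiv_dual hB' hnd'
  obtain ⟨k, hk⟩ := h.swap.exists_equiv_dual hB hnd
  obtain ⟨k', hk'⟩ := h'.swap.exists_equiv_dual hB' hnd'
  obtain ⟨f, hfp, hfm⟩ := exists_linearEquiv_extension_over
    (h.finrank_eq h' hB hB' hnd hnd' hVV')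
    (g := (P.comap Vm.subtype).subtype.dualMap ∘ₗ e.toLinearMap)
    (g' := jm.dualMap ∘ₗ e'.toLinearMap)
    ((LinearMap.dualMap_surjective_of_injective (Submodule.subtype_injective _)).comp e.surjective)
    ((LinearMap.dualMap_surjective_of_injective hjm_inj).comp e'.surjective)
    ⟨P.comap Vp.subtype, jp⟩ hjp_inj (fun x => by
      ext c
      change e' (jp x) (jm c) = e x.1 c.1
      rw [he, he', hjp, hjm, hiso])
  have hfm' : ∀ (a : Vp) (c : P.comap Vm.subtype), B' (f a) (jm c) = B a c.1 := fun a c => by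
    rw [← he', ← he]
    exact LinearMap.congr_fun (hfm a) c
  let g := k.trans (f.symm.dualMap.trans k'.symm)
  have hfg : ∀ a c, B' (f a) (g c) = B a c := fun a c => by
    rw [hB', hB, ← hk, ← hk']
    simp [g]
  refine ⟨f, g, hfg, fun a ha => ?_, fun c hc => ?_⟩
  · rw [hfp ⟨a, ha⟩]
    exact hjp ⟨a, ha⟩
  · rw [← hjm ⟨c, hc⟩, ← sub_eq_zero]
    refine h'.swap.eq_zero_of_orth hB' hnd' (sub_mem (g c).2 (jm _).2) fun u hu => ?_
    obtain ⟨a, ha⟩ := f.surjective ⟨u, hu⟩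
    rw [hB', show u = f a by rw [ha], map_sub, hfg, hfm', sub_self]

/-- An isometry which respects the components of two Witt decompositions extends to the
whole spaces. -/
theorem exists_isometry_extension [FiniteDimensional F V] [FiniteDimensional F V']
    (hchar : (2 : F) ≠ 0)
    (h : IsWittDecomposition B Vp Vh Vm) (h' : IsWittDecomposition B' Vp' Vh' Vm')
    (hB : ∀ u v, B u v = B v u) (hB' : ∀ u v, B' u v = B' v u)
    (hnd : B.Nondegenerate) (hnd' : B'.Nondegenerate) (hVV' : AreIsometric B B')
    {P : Submodule F V} (ψ : P →ₗ[F] V') (hψ : Function.Injective ψ)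
    (hiso : ∀ u v, B' (ψ u) (ψ v) = B u v)
    (hp : ∀ u : P, (u : V) ∈ Vp → ψ u ∈ Vp') (hh : ∀ u : P, (u : V) ∈ Vh → ψ u ∈ Vh')
    (hm : ∀ u : P, (u : V) ∈ Vm → ψ u ∈ Vm') :
    ∃ τ : V ≃ₗ[F] V', IsIsometry B B' τ ∧ Vp.map τ.toLinearMap = Vp' ∧
      Vh.map τ.toLinearMap = Vh' ∧ Vm.map τ.toLinearMap = Vm' ∧
      (∀ u : P, (u : V) ∈ Vp → τ u = ψ u) ∧ (∀ u : P, (u : V) ∈ Vh → τ u = ψ u) ∧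
      ∀ u : P, (u : V) ∈ Vm → τ u = ψ u := by
  obtain ⟨f, g, hfg, hf, hg⟩ :=
    h.exists_isotropic_extension h' hB hB' hnd hnd' hVV' ψ hψ hiso hp hm
  obtain ⟨j, hj⟩ := exists_restrict ψ hh
  let i : Vp × P.comap Vh.subtype × Vm →ₗ[F] V :=
    Vp.subtype.coprod ((Vh.subtype ∘ₗ (P.comap Vh.subtype).subtype).coprod Vm.subtype)
  let σ : Vp × P.comap Vh.subtype × Vm →ₗ[F] V' :=
    (Vp'.subtype ∘ₗ f.toLinearMap).coprod
      ((Vh'.subtype ∘ₗ j).coprod (Vm'.subtype ∘ₗ g.toLinearMap))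
  have hi : ∀ a b c, i (a, b, c) = a + ((b : Vh) + c) := fun _ _ _ => rfl
  have hσ : ∀ a b c, σ (a, b, c) = f a + (j b + g c) := fun _ _ _ => rfl
  have hBi : ∀ a b c a₁ b₁ c₁, B (i (a, b, c)) (i (a₁, b₁, c₁)) =
      B a c₁ + B b.1 b₁.1 + B c a₁ := by
    intro a b c a₁ b₁ c₁
    simp only [hi, map_add, LinearMap.add_apply, h.totIso_p _ a.2 _ a₁.2,
      h.totIso_m _ c.2 _ c₁.2, h.orth_p _ b.1.2 _ a₁.2, h.orth_m _ b.1.2 _ c₁.2,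
      hB a b₁.1, hB c b₁.1, h.orth_p _ b₁.1.2 _ a.2, h.orth_m _ b₁.1.2 _ c.2]
    ring
  have hBσ : ∀ x y, B' (σ x) (σ y) = B (i x) (i y) := by
    rintro ⟨a, b, c⟩ ⟨a₁, b₁, c₁⟩
    have hjj : B' (j b) (j b₁) = B b.1 b₁.1 := by rw [hj, hj, hiso]
    rw [hBi]
    simp only [hσ, map_add, LinearMap.add_apply, h'.totIso_p _ (f a).2 _ (f a₁).2,
      h'.totIso_m _ (g c).2 _ (g c₁).2, h'.orth_p _ (j b).2 _ (f a₁).2,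
      h'.orth_m _ (j b).2 _ (g c₁).2, hB' (f a) (j b₁), hB' (g c) (j b₁),
      h'.orth_p _ (j b₁).2 _ (f a).2, h'.orth_m _ (j b₁).2 _ (g c).2, hfg, hjj,
      hB' (g c) (f a₁), hB c a₁]
    ring
  obtain ⟨τ, hτ, hτi⟩ := Witt.exists_isometry_extension hchar hB hB' hVV' i σ (by
    rintro ⟨a, b, c⟩ hx
    have ha : (a : V) = 0 := h.eq_zero_of_orth hB hnd a.2 fun u hu => by
      simpa [hBi] using hx (0, 0, ⟨u, hu⟩)
    have hc : (c : V) = 0 := h.swap.eq_zero_of_orth hB hnd c.2 fun u hu => by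
      simpa [hBi] using hx (⟨u, hu⟩, 0, 0)
    have hb : ((b : Vh) : V) = 0 := by
      by_contra hb
      exact h.aniso _ b.1.2 hb (by simpa [hBi] using hx (0, b, 0))
    simp only [ZeroMemClass.coe_eq_zero] at ha hb hc
    simp [ha, hb, hc]) hBσ
  have hτp : ∀ a : Vp, τ a = f a := fun a => by simpa [hi, hσ] using hτi (a, 0, 0)
  have hτh : ∀ b : P.comap Vh.subtype, τ b.1 = j b := fun b => by
    simpa [hi, hσ] using hτi (0, b, 0)
  have hτm : ∀ c : Vm, τ c = g c := fun c => by simpa [hi, hσ] using hτi (0, 0, c)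
  refine ⟨τ, hτ, ?_, ?_, ?_, fun u hu => ?_, fun u hu => ?_, fun u hu => ?_⟩
  · ext x
    refine ⟨?_, fun hx => ⟨f.symm ⟨x, hx⟩, SetLike.coe_mem _, ?_⟩⟩
    · rintro ⟨a, ha, rfl⟩
      exact (hτp ⟨a, ha⟩).symm ▸ (f _).2
    · exact (hτp _).trans (by simp)
  · ext x
    rw [Submodule.mem_map_equiv, h.mem_aniso_iff hB hnd, h'.mem_aniso_iff hB' hnd']
    refine and_congr ⟨fun hx u hu => ?_, fun hx u hu => ?_⟩
      ⟨fun hx u hu => ?_, fun hx u hu => ?_⟩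
    · have := hx (f.symm ⟨u, hu⟩) (SetLike.coe_mem _)
      rwa [← hτ, τ.apply_symm_apply, hτp, f.apply_symm_apply] at this
    · rw [← hτ, τ.apply_symm_apply, hτp ⟨u, hu⟩]
      exact hx _ (SetLike.coe_mem _)
    · have := hx (g.symm ⟨u, hu⟩) (SetLike.coe_mem _)
      rwa [← hτ, τ.apply_symm_apply, hτm, g.apply_symm_apply] at this
    · rw [← hτ, τ.apply_symm_apply, hτm ⟨u, hu⟩]
      exact hx _ (SetLike.coe_mem _)
  · ext x
    refine ⟨?_, fun hx => ⟨g.symm ⟨x, hx⟩, SetLike.coe_mem _, ?_⟩⟩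
    · rintro ⟨c, hc, rfl⟩
      exact (hτm ⟨c, hc⟩).symm ▸ (g _).2
    · exact (hτm _).trans (by simp)
  · exact (hτp ⟨u, hu⟩).trans (hf ⟨u, hu⟩ u.2)
  · exact (hτh ⟨⟨u, hu⟩, u.2⟩).trans (hj _)
  · exact (hτm ⟨u, hu⟩).trans (hg ⟨u, hu⟩ u.2)

end IsWittDecomposition

/-- Corollary 4.6: an isometry `φ : E → E'` extends to an isometry `V → V'`
sending a given Witt decomposition to another iff the three intersection
conditions hold and the induced map `φ̃_{V⁺,V̂,V⁻}` is an isometry. -/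
theorem witt_extension_witt_decomposition {F V V' : Type*} [Field F]
    [AddCommGroup V] [Module F V] [AddCommGroup V'] [Module F V']
    [FiniteDimensional F V] [FiniteDimensional F V']
    (hchar : (2 : F) ≠ 0)
    (B : LinearMap.BilinForm F V) (B' : LinearMap.BilinForm F V')
    (hB : ∀ u v : V, B u v = B v u) (hB' : ∀ u v : V', B' u v = B' v u)
    (hnd : B.Nondegenerate) (hnd' : B'.Nondegenerate)
    (hVV' : AreIsometric B B')
    (Vp Vh Vm : Submodule F V) (Vp' Vh' Vm' : Submodule F V')
    (hWitt : IsWittDecomposition B Vp Vh Vm)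
    (hWitt' : IsWittDecomposition B' Vp' Vh' Vm')
    (E : Submodule F V) (E' : Submodule F V')
    (φ : E ≃ₗ[F] E') (hφ : IsIsometryOn B B' E E' φ) :
    (∃ φV : V ≃ₗ[F] V', IsIsometry B B' φV ∧
        (∀ e : E, φV (e : V) = (φ e : V')) ∧
        Vp.map φV.toLinearMap = Vp' ∧ Vh.map φV.toLinearMap = Vh' ∧
        Vm.map φV.toLinearMap = Vm') ↔
      ((∀ e : E, (e : V) ∈ Vp ⊔ Vm ↔ (φ e : V') ∈ Vp' ⊔ Vm') ∧
       (∀ e : E, (e : V) ∈ Vm ⊔ Vh ↔ (φ e : V') ∈ Vm' ⊔ Vh') ∧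
       (∀ e : E, (e : V) ∈ Vh ⊔ Vp ↔ (φ e : V') ∈ Vh' ⊔ Vp') ∧
       ∃ ψ : ↥(Pproj3 Vp Vh Vm E) ≃ₗ[F] ↥(Pproj3 Vp' Vh' Vm' E'),
         -- `ψ` is the induced map `φ̃_{V⁺,V̂,V⁻}`
         (∀ (v vA vB vC : V) (hv : v ∈ E), vA ∈ Vp → vB ∈ Vh → vC ∈ Vm →
           v = vA + vB + vC →
           ∀ (vA' vB' vC' : V'), vA' ∈ Vp' → vB' ∈ Vh' → vC' ∈ Vm' →
             (φ ⟨v, hv⟩ : V') = vA' + vB' + vC' →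
           ∀ (hAP : vA ∈ Pproj3 Vp Vh Vm E) (hBP : vB ∈ Pproj3 Vp Vh Vm E)
             (hCP : vC ∈ Pproj3 Vp Vh Vm E)
             (hAP' : vA' ∈ Pproj3 Vp' Vh' Vm' E')
             (hBP' : vB' ∈ Pproj3 Vp' Vh' Vm' E')
             (hCP' : vC' ∈ Pproj3 Vp' Vh' Vm' E'),
             ψ ⟨vA, hAP⟩ = ⟨vA', hAP'⟩ ∧ ψ ⟨vB, hBP⟩ = ⟨vB', hBP'⟩ ∧
               ψ ⟨vC, hCP⟩ = ⟨vC', hCP'⟩) ∧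
         -- `ψ` is an isometry
         IsIsometryOn B B' (Pproj3 Vp Vh Vm E) (Pproj3 Vp' Vh' Vm' E') ψ) := by
  constructor
  · rintro ⟨τ, hτ, hτφ, rfl, rfl, rfl⟩
    have hmem : ∀ (X Y : Submodule F V) (e : E),
        (e : V) ∈ X ⊔ Y ↔ (φ e : V') ∈ X.map τ.toLinearMap ⊔ Y.map τ.toLinearMap := by
      intro X Y e
      rw [← Submodule.map_sup, ← hτφ, Submodule.mem_map_equiv, τ.symm_apply_apply]
    have hE : E.map τ.toLinearMap = E' := by
      ext x
      refine ⟨?_, fun hx => ⟨φ.symm ⟨x, hx⟩, SetLike.coe_mem _, ?_⟩⟩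
      · rintro ⟨e, he, rfl⟩
        exact (hτφ ⟨e, he⟩).symm ▸ (φ _).2
      · exact (hτφ _).trans (by simp)
    have hP := map_Pproj3 (X := Vp) (Y := Vh) (Z := Vm) (E := E) τ
    rw [hE] at hP
    refine ⟨hmem _ _, hmem _ _, hmem _ _,
      τ.ofSubmodules _ _ hP, ?_, fun u v => hτ u v⟩
    rintro v a b c hv ha hb hc rfl a' b' c' ha' hb' hc' hφv - - - - - -
    obtain ⟨a', ha', rfl⟩ := ha'
    obtain ⟨b', hb', rfl⟩ := hb'
    obtain ⟨c', hc', rfl⟩ := hc'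
    have hsum : a + b + c = a' + b' + c' := τ.injective (by
      rw [map_add τ (a' + b'), map_add τ a']
      exact (hτφ ⟨_, hv⟩).trans hφv)
    have haa : a = a' := by
      have : a - a' ∈ Vp ⊓ (Vh ⊔ Vm) := by
        refine ⟨sub_mem ha ha', ?_⟩
        rw [show a - a' = (b' - b) + (c' - c) by
          rw [show a - a' = a + b + c - a' - b - c by abel, hsum]; abel]
        exact Submodule.add_mem_sup (sub_mem hb' hb) (sub_mem hc' hc)
      rwa [hWitt.disj_p, Submodule.mem_bot, sub_eq_zero] at this
    have hcc : c = c' := by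
      have : c - c' ∈ Vm ⊓ (Vp ⊔ Vh) := by
        refine ⟨sub_mem hc hc', ?_⟩
        rw [show c - c' = (a' - a) + (b' - b) by
          rw [show c - c' = a + b + c - c' - a - b by abel, hsum]; abel]
        exact Submodule.add_mem_sup (sub_mem ha' ha) (sub_mem hb' hb)
      rwa [hWitt.disj_m, Submodule.mem_bot, sub_eq_zero] at this
    subst haa hcc
    have hbb : b = b' := by simpa using hsum
    subst hbb
    exact ⟨rfl, rfl, rfl⟩
  · rintro ⟨-, -, -, ψ, hψφ, hψ⟩
    have key : ∀ a b c (ha : a ∈ Vp) (hb : b ∈ Vh) (hc : c ∈ Vm) (he : a + b + c ∈ E),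
        ∃ (hP : a ∈ Pproj3 Vp Vh Vm E ∧ b ∈ Pproj3 Vp Vh Vm E ∧ c ∈ Pproj3 Vp Vh Vm E),
        (ψ ⟨a, hP.1⟩ : V') ∈ Vp' ∧ (ψ ⟨b, hP.2.1⟩ : V') ∈ Vh' ∧ (ψ ⟨c, hP.2.2⟩ : V') ∈ Vm' ∧
        (φ ⟨_, he⟩ : V') = ψ ⟨a, hP.1⟩ + ψ ⟨b, hP.2.1⟩ + ψ ⟨c, hP.2.2⟩ := by
      intro a b c ha hb hc he
      have hP := mem_Pproj3_of_add_mem he ha hb hc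
      obtain ⟨a', ha', b', hb', c', hc', hφ'⟩ := hWitt'.exists_eq_add (φ ⟨_, he⟩ : V')
      have hP' := mem_Pproj3_of_add_mem (hφ' ▸ (φ ⟨_, he⟩).2) ha' hb' hc'
      obtain ⟨h1, h2, h3⟩ := hψφ _ a b c he ha hb hc rfl a' b' c' ha' hb' hc' hφ'
        hP.1 hP.2.1 hP.2.2 hP'.1 hP'.2.1 hP'.2.2
      refine ⟨hP, ?_⟩
      rw [h1, h2, h3]
      exact ⟨ha', hb', hc', hφ'⟩
    obtain ⟨τ, hτ, hp, hh, hm, hτp, hτh, hτm⟩ := hWitt.exists_isometry_extension hchar hWitt'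
      hB hB' hnd hnd' hVV' ((Pproj3 Vp' Vh' Vm' E').subtype ∘ₗ ψ.toLinearMap)
      ((Submodule.subtype_injective _).comp ψ.injective) hψ
      (by
        rintro ⟨u, hu⟩ huX
        obtain ⟨b, hb, c, hc, he⟩ := exists_add_mem_of_mem_Pproj3 hWitt.disj_p hu huX
        exact (key u b c huX hb hc he).2.1)
      (by
        rintro ⟨u, hu⟩ huX
        have hu' := hu
        rw [Pproj3_rotate] at hu'
        obtain ⟨c, hc, a, ha, he⟩ := exists_add_mem_of_mem_Pproj3
          (by rw [sup_comm, hWitt.disj_h]) hu' huX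
        exact (key a u c ha huX hc (by rwa [show a + u + c = u + c + a by abel])).2.2.1)
      (by
        rintro ⟨u, hu⟩ huX
        have hu' := hu
        rw [← Pproj3_rotate] at hu'
        obtain ⟨a, ha, b, hb, he⟩ := exists_add_mem_of_mem_Pproj3 hWitt.disj_m hu' huX
        exact (key a b u ha hb huX (by rwa [show a + b + u = u + a + b by abel])).2.2.2.1)
    refine ⟨τ, hτ, ?_, hp, hh, hm⟩
    rintro ⟨e, he⟩
    obtain ⟨a, ha, b, hb, c, hc, rfl⟩ := hWitt.exists_eq_add e
    obtain ⟨hP, -, -, -, hsum⟩ := key a b c ha hb hc he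
    rw [hsum, map_add, map_add]
    exact congrArg₂ _ (congrArg₂ _ (hτp ⟨a, hP.1⟩ ha) (hτh ⟨b, hP.2.1⟩ hb))
      (hτm ⟨c, hP.2.2⟩ hc)
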